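/- arXiv:1806.10973 — 2 statements merged into one kernel-verified Lean document; each statement's English description precedes it below -/
import Mathlib

section
/- For every N ≥ 2 and every q ∈ [0,1], the probability of success of the W-state anonymous transmission protocol under N-fold dephasing noise is the same as in the noiseless case: Tr[𝒫_q^{⊗N}(|W_N⟩⟨W_N|)·(1⊗P₀)] = 2/N. -/
open Finset

/-- The N-qubit W state: amplitude `1/√N` on strings with exactly one coordinate
equal to 1, and 0 otherwise. -/
noncomputable def Wstate (N : ℕ) (x : Fin N → Fin 2) : ℂ :=
  if (∑ i, (x i : ℕ)) = 1 then ((1 / Real.sqrt N : ℝ) : ℂ) else 0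

/-- The N-fold dephasing channel with parameter q acting entrywise:
(𝒫_q^{⊗N} ρ)_{x,y} = (2q−1)^{d(x,y)} ρ_{x,y}, with d the Hamming distance. -/
noncomputable def dephase (N : ℕ) (q : ℝ)
    (ρ : (Fin N → Fin 2) → (Fin N → Fin 2) → ℂ) (x y : Fin N → Fin 2) : ℂ :=
  (((2 * q - 1) ^ hammingDist x y : ℝ) : ℂ) * ρ x y

/-- A bit string has weight one iff it is a standard basis string. -/
theorem sum_val_eq_one_iff_exists_single {N : ℕ} (x : Fin N → Fin 2) :
    (∑ i, (x i : ℕ)) = 1 ↔ ∃ i, x = Pi.single i 1 := by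
  constructor
  · intro h
    obtain ⟨i, hi⟩ : ∃ i, x i ≠ 0 := by
      by_contra! h0
      simp [h0] at h
    refine ⟨i, ?_⟩
    have hs := Finset.add_sum_erase Finset.univ (fun j => (x j : ℕ)) (Finset.mem_univ i)
    have h0 : ∑ j ∈ Finset.univ.erase i, (x j : ℕ) = 0 := by grind
    rw [Finset.sum_eq_zero_iff] at h0
    ext j
    by_cases hj : j = i
    · subst hj
      simp only [Pi.single_eq_same]
      grind
    · simpa [hj] using h0 j (by simp [hj])
  · rintro ⟨i, rfl⟩
    rw [Finset.sum_eq_single i] <;> simp +contextual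

/-- Dephasing fixes the diagonal, which for the W state is uniform on weight-one strings. -/
theorem dephase_Wstate_diag (N : ℕ) (q : ℝ) (x : Fin N → Fin 2) :
    dephase N q (fun x y => Wstate N x * (starRingEnd ℂ) (Wstate N y)) x x
      = if (∑ i, (x i : ℕ)) = 1 then (1 : ℂ) / N else 0 := by
  simp only [dephase, hammingDist_self, pow_zero, Complex.ofReal_one, one_mul, Wstate]
  split_ifs
  · rw [Complex.conj_ofReal, ← Complex.ofReal_mul, div_mul_div_comm,
      Real.mul_self_sqrt (Nat.cast_nonneg N)]
    simp
  · simp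

/-- Exactly two weight-one strings vanish beyond the first two coordinates. -/
theorem card_weight_one_supported_on_first_two {N : ℕ} (hN : 2 ≤ N) :
    #{x : Fin N → Fin 2 | (∀ i : Fin N, 2 ≤ (i : ℕ) → x i = 0) ∧ (∑ i, (x i : ℕ)) = 1} = 2 := by
  have hset : ({x : Fin N → Fin 2 |
      (∀ i : Fin N, 2 ≤ (i : ℕ) → x i = 0) ∧ (∑ i, (x i : ℕ)) = 1} : Finset _)
      = {Pi.single ⟨0, by omega⟩ 1, Pi.single ⟨1, by omega⟩ 1} := by
    ext x
    simp only [Finset.mem_filter, Finset.mem_univ, true_and, Finset.mem_insert,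
      Finset.mem_singleton, sum_val_eq_one_iff_exists_single]
    constructor
    · rintro ⟨h, i, rfl⟩
      have hi : (i : ℕ) < 2 := by
        by_contra! hi
        simpa using h i hi
      obtain ⟨i, hiN⟩ := i
      have : i = 0 ∨ i = 1 := by grind
      rcases this with rfl | rfl <;> simp
    · rintro (rfl | rfl) <;>
      · refine ⟨fun i hi => Pi.single_eq_of_ne ?_ _, _, rfl⟩
        rintro rfl
        simp at hi
  rw [hset, Finset.card_pair]
  intro h
  simpa [Pi.single_apply, Fin.ext_iff, -Fin.mk_zero] using congrFun h ⟨0, by omega⟩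

/-- The probability of success of the W-state protocol under N-fold dephasing
noise is the same as in the noiseless case:
Tr[𝒫_q^{⊗N}(|W_N⟩⟨W_N|)·(1⊗P₀)] = 2/N. -/
theorem W_dephasing_success_probability (N : ℕ) (hN : 2 ≤ N)
    (q : ℝ) (hq : q ∈ Set.Icc (0 : ℝ) 1) :
    (∑ x ∈ Finset.univ.filter
        (fun x : Fin N → Fin 2 => ∀ i : Fin N, 2 ≤ (i : ℕ) → x i = 0),
      dephase N q (fun x y => Wstate N x * (starRingEnd ℂ) (Wstate N y)) x x)
    = (2 : ℂ) / N := by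
  simp only [dephase_Wstate_diag]
  rw [← Finset.sum_filter, Finset.filter_filter, Finset.sum_const,
    card_weight_one_supported_on_first_two hN, nsmul_eq_mul]
  push_cast
  ring
end

section
/- For every N ≥ 2 and every q ∈ [0,1], the fidelity of the anonymous entanglement produced by the W-state protocol under N-fold depolarizing noise equals (1+q)(N(q−1)² + 4q(1+q)) / (4(N(1−q)+4q)). Precisely, with ρ = 𝒟_q^{⊗N}(|W_N⟩⟨W_N|) and v = ψ⁺ ⊗ |0…0⟩, one has ⟨v, ρ v⟩ / Tr[ρ·(1⊗P₀)] = (1+q)(N(q−1)² + 4q(1+q)) / (4(N(1−q)+4q)). -/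
open Finset

/-- The two-qubit maximally entangled state ψ⁺: amplitude 1/√2 on the strings
01 and 10 and 0 elsewhere. -/
noncomputable def psiPlus (a : Fin 2 → Fin 2) : ℂ :=
  if (a 0 = 0 ∧ a 1 = 1) ∨ (a 0 = 1 ∧ a 1 = 0) then ((1 / Real.sqrt 2 : ℝ) : ℂ) else 0

/-- The N-qubit vector ψ⁺ ⊗ |0…0⟩: ψ⁺ on the first two qubits and |0⟩ on each
of the last N−2 qubits. -/
noncomputable def psiPlusExt (N : ℕ) (hN : 2 ≤ N) (x : Fin N → Fin 2) : ℂ :=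
  if ∀ i : Fin N, 2 ≤ (i : ℕ) → x i = 0 then
    psiPlus (fun j : Fin 2 => x (Fin.castLE hN j)) else 0

/-- The N-fold depolarizing channel with parameter q:
𝒟_q^{⊗N}(ρ) = Σ_{S ⊆ Fin N} q^{N−|S|}(1−q)^{|S|} Φ_S(ρ), where Φ_S replaces
the qubits in S by the maximally mixed state. -/
noncomputable def depolarize (N : ℕ) (q : ℝ)
    (ρ : (Fin N → Fin 2) → (Fin N → Fin 2) → ℂ) (x y : Fin N → Fin 2) : ℂ :=
  ∑ S : Finset (Fin N),
    ((q ^ (N - S.card) * (1 - q) ^ S.card : ℝ) : ℂ) *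
      (if ∀ i ∈ S, x i = y i then
        ((2 : ℂ) ^ S.card)⁻¹ *
          ∑ z : {i // i ∈ S} → Fin 2,
            ρ (fun j => if h : j ∈ S then z ⟨j, h⟩ else x j)
              (fun j => if h : j ∈ S then z ⟨j, h⟩ else y j)
      else 0)

/-- The matrix entry `(u, v)` of the image of `|s⟩⟨t|` under the single-qubit depolarizing
channel. -/
noncomputable def depolarizeEntry (q : ℝ) (u v s t : Fin 2) : ℂ :=
  q * ((if u = s then 1 else 0) * (if v = t then 1 else 0)) +
    (1 - q) / 2 * ((if u = v then 1 else 0) * (if s = t then 1 else 0))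

lemma depolarize_sum {ι : Type*} (s : Finset ι) (N : ℕ) (q : ℝ) (c : ℂ)
    (ρ : ι → (Fin N → Fin 2) → (Fin N → Fin 2) → ℂ) (x y : Fin N → Fin 2) :
    depolarize N q (fun x y => c * ∑ a ∈ s, ρ a x y) x y =
      c * ∑ a ∈ s, depolarize N q (ρ a) x y := by
  unfold depolarize
  rw [Finset.sum_comm, Finset.mul_sum]
  refine Finset.sum_congr rfl fun S _ => ?_
  split_ifs
  · simp_rw [← Finset.mul_sum]
    rw [Finset.sum_comm]
    ring
  · simp

/-- The depolarizing channel acts factorwise on product operators. -/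
lemma depolarize_prod (N : ℕ) (q : ℝ) (f : Fin N → Fin 2 → Fin 2 → ℂ) (x y : Fin N → Fin 2) :
    depolarize N q (fun x y => ∏ i, f i (x i) (y i)) x y =
      ∏ i, (q * f i (x i) (y i) +
        (1 - q) / 2 * ((if x i = y i then 1 else 0) * ∑ z, f i z z)) := by
  unfold depolarize
  simp_rw [add_comm ((q : ℂ) * _)]
  rw [Finset.prod_add, Finset.powerset_univ]
  refine Finset.sum_congr rfl fun S _ => ?_
  have hz : ∑ z : {i // i ∈ S} → Fin 2,
      ∏ i, f i (if h : i ∈ S then z ⟨i, h⟩ else x i) (if h : i ∈ S then z ⟨i, h⟩ else y i) =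
      (∏ i ∈ S, ∑ z, f i z z) * ∏ i ∈ univ \ S, f i (x i) (y i) := by
    rw [← Finset.prod_coe_sort S, Finset.prod_univ_sum, Finset.sum_mul, Fintype.piFinset_univ]
    refine Finset.sum_congr rfl fun z _ => ?_
    rw [← Finset.prod_sdiff (Finset.subset_univ S), mul_comm, ← Finset.prod_coe_sort S]
    congr 1
    · exact Finset.prod_congr rfl fun i _ => by simp
    · refine Finset.prod_congr rfl fun i hi => ?_
      have : i ∉ S := (Finset.mem_sdiff.mp hi).2
      simp [this]
  rw [hz, Finset.prod_mul_distrib, Finset.prod_mul_distrib, Finset.prod_mul_distrib,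
    Finset.prod_const, Finset.prod_const, Finset.prod_boole, Finset.card_sdiff_of_subset
    (Finset.subset_univ S), Finset.card_univ, Fintype.card_fin]
  split_ifs
  · push_cast
    rw [div_pow]
    ring
  · simp

lemma sum_val_eq_one_iff {N : ℕ} (x : Fin N → Fin 2) :
    (∑ i, (x i : ℕ)) = 1 ↔ ∃ a, x = Pi.single a 1 := by
  constructor
  · intro h
    obtain ⟨a, -, ha⟩ : ∃ a ∈ univ, (x a : ℕ) ≠ 0 :=
      Finset.exists_ne_zero_of_sum_ne_zero (by omega)
    rw [← Finset.add_sum_erase _ _ (Finset.mem_univ a)] at h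
    have h0 : ∑ i ∈ univ.erase a, (x i : ℕ) = 0 := by omega
    rw [Finset.sum_eq_zero_iff] at h0
    refine ⟨a, funext fun i => ?_⟩
    by_cases hi : i = a
    · subst hi
      simp only [Pi.single_eq_same]
      omega
    · have := h0 i (by simp [hi])
      simp only [Pi.single_eq_of_ne hi]
      omega
  · rintro ⟨a, rfl⟩
    rw [Finset.sum_eq_single a] <;> simp +contextual

lemma single_one_injective {N : ℕ} :
    Function.Injective fun a : Fin N => (Pi.single a 1 : Fin N → Fin 2) := by
  intro a b h
  by_contra hab
  have := congrFun h a
  simp [hab] at this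

lemma Wstate_eq (N : ℕ) (x : Fin N → Fin 2) :
    Wstate N x = ((1 / Real.sqrt N : ℝ) : ℂ) *
      ∑ a, if x = Pi.single a 1 then (1 : ℂ) else 0 := by
  unfold Wstate
  split_ifs with h
  · obtain ⟨a, rfl⟩ := (sum_val_eq_one_iff x).mp h
    have (b : Fin N) : (Pi.single a 1 : Fin N → Fin 2) = Pi.single b 1 ↔ a = b :=
      single_one_injective.eq_iff
    simp [this]
  · rw [sum_val_eq_one_iff, not_exists] at h
    simp [h]

lemma depolarize_Wstate (N : ℕ) (q : ℝ) (x y : Fin N → Fin 2) :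
    depolarize N q (fun x y => Wstate N x * (starRingEnd ℂ) (Wstate N y)) x y =
      1 / N * ∑ ab : Fin N × Fin N, ∏ i, depolarizeEntry q (x i) (y i)
        ((Pi.single ab.1 1 : Fin N → Fin 2) i) ((Pi.single ab.2 1 : Fin N → Fin 2) i) := by
  have hW : (fun x y => Wstate N x * (starRingEnd ℂ) (Wstate N y)) = fun x y =>
      (1 / N : ℂ) * ∑ ab : Fin N × Fin N, ∏ i,
        ((if x i = (Pi.single ab.1 1 : Fin N → Fin 2) i then (1 : ℂ) else 0) *
          (if y i = (Pi.single ab.2 1 : Fin N → Fin 2) i then 1 else 0)) := by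
    funext x y
    have hs : ((1 / Real.sqrt N : ℝ) : ℂ) * ((1 / Real.sqrt N : ℝ) : ℂ) = 1 / N := by
      rw [← Complex.ofReal_mul, div_mul_div_comm, Real.mul_self_sqrt (Nat.cast_nonneg N)]
      simp
    simp_rw [Finset.prod_mul_distrib, Finset.prod_boole, Finset.mem_univ, true_imp_iff,
      ← funext_iff]
    rw [Wstate_eq, Wstate_eq, map_mul, map_sum, Complex.conj_ofReal, mul_mul_mul_comm, hs,
      Finset.sum_mul_sum, Fintype.sum_prod_type]
    congr 1
    refine Finset.sum_congr rfl fun a _ => Finset.sum_congr rfl fun b _ => ?_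
    congr 1
    split_ifs <;> simp
  rw [hW, depolarize_sum]
  congr 1
  refine Finset.sum_congr rfl fun ab _ => ?_
  rw [depolarize_prod N q (fun i u v =>
    (if u = (Pi.single ab.1 1 : Fin N → Fin 2) i then (1 : ℂ) else 0) *
      (if v = (Pi.single ab.2 1 : Fin N → Fin 2) i then 1 else 0))]
  refine Finset.prod_congr rfl fun i _ => ?_
  unfold depolarizeEntry
  congr 3
  rw [Finset.sum_eq_single ((Pi.single ab.1 1 : Fin N → Fin 2) i)] <;> simp +contextual

lemma depolarize_Wstate_diag (N : ℕ) (q : ℝ) (x : Fin N → Fin 2) :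
    depolarize N q (fun x y => Wstate N x * (starRingEnd ℂ) (Wstate N y)) x x =
      1 / N * ∑ a : Fin N, ∏ i,
        (if x i = (Pi.single a 1 : Fin N → Fin 2) i then ((1 + q) / 2 : ℂ) else (1 - q) / 2) := by
  rw [depolarize_Wstate, Fintype.sum_prod_type]
  congr 1
  refine Finset.sum_congr rfl fun a _ => ?_
  rw [Finset.sum_eq_single a]
  · refine Finset.prod_congr rfl fun i _ => ?_
    unfold depolarizeEntry
    by_cases h : x i = (Pi.single a 1 : Fin N → Fin 2) i
    · simp [h]
      ring
    · simp [h]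
  · intro b _ hb
    refine Finset.prod_eq_zero (Finset.mem_univ a) ?_
    unfold depolarizeEntry
    rw [Pi.single_eq_same, Pi.single_eq_of_ne hb.symm]
    obtain h | h : x a = 0 ∨ x a = 1 := by omega
    all_goals simp [h]
  · simp

lemma depolarize_Wstate_single (N : ℕ) (q : ℝ) (hq : (1 + q : ℂ) ≠ 0) (c : Fin N) :
    depolarize N q (fun x y => Wstate N x * (starRingEnd ℂ) (Wstate N y))
      (Pi.single c 1) (Pi.single c 1) =
      1 / N * ((1 + q) / 2) ^ N * (1 + (N - 1) * ((1 - q) / (1 + q)) ^ 2) := by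
  rw [depolarize_Wstate_diag, mul_assoc]
  congr 1
  have key (a : Fin N) : ∏ i, (if (Pi.single c 1 : Fin N → Fin 2) i =
      (Pi.single a 1 : Fin N → Fin 2) i then ((1 + q) / 2 : ℂ) else (1 - q) / 2) =
      ((1 + q) / 2) ^ N * (((1 - q) / (1 + q)) ^ 2 +
        if a = c then (1 - ((1 - q) / (1 + q)) ^ 2 : ℂ) else 0) := by
    by_cases hac : a = c
    · simp [hac, div_pow]
    · have (i : Fin N) : (if (Pi.single c 1 : Fin N → Fin 2) i =
          (Pi.single a 1 : Fin N → Fin 2) i then ((1 + q) / 2 : ℂ) else (1 - q) / 2) =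
          (1 + q) / 2 * ((if i = a then ((1 - q) / (1 + q) : ℂ) else 1) *
            (if i = c then ((1 - q) / (1 + q) : ℂ) else 1)) := by
        by_cases h1 : i = a
        · subst h1
          simp [hac]
          field_simp
        · by_cases h2 : i = c
          · subst h2
            simp [h1]
            field_simp
          · simp [h1, h2]
      simp_rw [this, Finset.prod_mul_distrib]
      simp [hac, sq, div_pow]
  simp_rw [key]
  rw [← Finset.mul_sum, Finset.sum_add_distrib, Finset.sum_const, Finset.sum_ite_eq',
    if_pos (Finset.mem_univ c), Finset.card_univ, Fintype.card_fin, nsmul_eq_mul]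
  ring

lemma depolarize_Wstate_single_ne (N : ℕ) (q : ℝ) (hq : (1 + q : ℂ) ≠ 0) (c d : Fin N)
    (hcd : c ≠ d) :
    depolarize N q (fun x y => Wstate N x * (starRingEnd ℂ) (Wstate N y))
      (Pi.single c 1) (Pi.single d 1) =
      1 / N * ((1 + q) / 2) ^ N * (2 * q / (1 + q)) ^ 2 := by
  rw [depolarize_Wstate, mul_assoc]
  congr 1
  rw [Finset.sum_eq_single (c, d)]
  · have (i : Fin N) : depolarizeEntry q ((Pi.single c 1 : Fin N → Fin 2) i)
        ((Pi.single d 1 : Fin N → Fin 2) i) ((Pi.single c 1 : Fin N → Fin 2) i)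
        ((Pi.single d 1 : Fin N → Fin 2) i) =
        (1 + q) / 2 * ((if i = c then (2 * q / (1 + q) : ℂ) else 1) *
            (if i = d then (2 * q / (1 + q) : ℂ) else 1)) := by
      unfold depolarizeEntry
      by_cases h1 : i = c
      · subst h1
        simp [hcd]
        field_simp
      · by_cases h2 : i = d
        · subst h2
          simp [h1]
          field_simp
        · simp [h1, h2]
          ring
    simp_rw [this, Finset.prod_mul_distrib]
    simp [sq, div_pow]
  · rintro ⟨a, b⟩ - hab
    by_cases hac : a = c
    · have hbd : d ≠ b := fun h => hab (by rw [hac, h])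
      refine Finset.prod_eq_zero (Finset.mem_univ d) ?_
      simp [depolarizeEntry, hcd.symm, hbd]
    · refine Finset.prod_eq_zero (Finset.mem_univ c) ?_
      simp [depolarizeEntry, hcd, Ne.symm hac]
  · simp

/-- The trace of the depolarized W state against the projection onto the all-zero string of the
qubits other than `c` and `d`. -/
lemma sum_depolarize_Wstate_diag (N : ℕ) (q : ℝ) (hq : (1 + q : ℂ) ≠ 0) (c d : Fin N)
    (hcd : c ≠ d) :
    ∑ x ∈ univ.filter (fun x : Fin N → Fin 2 => ∀ i, i ≠ c ∧ i ≠ d → x i = 0),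
      depolarize N q (fun x y => Wstate N x * (starRingEnd ℂ) (Wstate N y)) x x =
      1 / N * ((1 + q) / 2) ^ N * (2 / (1 + q)) ^ 2 *
        (2 + (N - 2) * ((1 - q) / (1 + q))) := by
  simp_rw [depolarize_Wstate_diag]
  rw [← Finset.mul_sum, Finset.sum_comm, mul_assoc, mul_assoc]
  congr 1
  have hset : univ.filter (fun x : Fin N → Fin 2 => ∀ i, i ≠ c ∧ i ≠ d → x i = 0) =
      Fintype.piFinset fun i => if i ≠ c ∧ i ≠ d then {0} else univ := by
    ext x
    simp only [Finset.mem_filter, Finset.mem_univ, true_and, Fintype.mem_piFinset]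
    refine forall_congr' fun i => ?_
    split_ifs with h <;> simp [h]
  have key (a : Fin N) : ∑ x ∈ univ.filter (fun x : Fin N → Fin 2 => ∀ i, i ≠ c ∧ i ≠ d → x i = 0),
      ∏ i, (if x i = (Pi.single a 1 : Fin N → Fin 2) i then ((1 + q) / 2 : ℂ) else (1 - q) / 2) =
      ((1 + q) / 2) ^ N * (2 / (1 + q)) ^ 2 * ((1 - q) / (1 + q) +
        ((if a = c then (1 - (1 - q) / (1 + q) : ℂ) else 0) +
          (if a = d then (1 - (1 - q) / (1 + q) : ℂ) else 0))) := by
    rw [hset, ← Finset.prod_univ_sum (fun i => if i ≠ c ∧ i ≠ d then {0} else univ)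
      (fun i u => if u = (Pi.single a 1 : Fin N → Fin 2) i
        then ((1 + q) / 2 : ℂ) else (1 - q) / 2)]
    have (i : Fin N) : ∑ u ∈ (if i ≠ c ∧ i ≠ d then {0} else univ : Finset (Fin 2)),
        (if u = (Pi.single a 1 : Fin N → Fin 2) i then ((1 + q) / 2 : ℂ) else (1 - q) / 2) =
        (1 + q) / 2 * ((if i = c then (2 / (1 + q) : ℂ) else 1) * (if i = d then (2 / (1 + q) : ℂ) else 1) *
          (if i = a then (if a = c ∨ a = d then 1 else ((1 - q) / (1 + q) : ℂ)) else 1)) := by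
      have hsum (s : Fin 2) :
          ∑ u, (if u = s then ((1 + q) / 2 : ℂ) else (1 - q) / 2) = 1 := by
        fin_cases s <;> simp [Fin.sum_univ_two] <;> ring
      by_cases h1 : i = c
      · subst h1
        simp only [ne_eq, not_true_eq_false, false_and, if_false, hsum, hcd]
        by_cases ha : i = a
        · subst ha
          simp
          field_simp
        · simp [ha]
          field_simp
      · by_cases h2 : i = d
        · subst h2
          simp only [ne_eq, not_true_eq_false, and_false, if_false, hsum, h1]
          by_cases ha : i = a
          · subst ha
            simp
            field_simp
          · simp [ha]
            field_simp
        · by_cases ha : i = a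
          · subst ha
            simp [h1, h2]
            field_simp
          · simp [h1, h2, ha]
    simp_rw [this, Finset.prod_mul_distrib]
    by_cases hac : a = c
    · subst hac
      simp [hcd, sq, div_pow]
    · by_cases had : a = d
      · subst had
        simp [hac, sq, div_pow]
      · simp [hac, had, sq, div_pow]
        ring
  simp_rw [key]
  rw [← Finset.mul_sum, Finset.sum_add_distrib, Finset.sum_add_distrib, Finset.sum_const,
    Finset.sum_ite_eq', Finset.sum_ite_eq', if_pos (Finset.mem_univ c),
    if_pos (Finset.mem_univ d), Finset.card_univ, Fintype.card_fin, nsmul_eq_mul]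
  ring

lemma psiPlusExt_eq (N : ℕ) (hN : 2 ≤ N) (x : Fin N → Fin 2) :
    psiPlusExt N hN x = ((1 / Real.sqrt 2 : ℝ) : ℂ) *
      ((if x = Pi.single (Fin.castLE hN 0) 1 then 1 else 0) +
        (if x = Pi.single (Fin.castLE hN 1) 1 then 1 else 0)) := by
  obtain ⟨n, rfl⟩ := Nat.exists_eq_add_of_le' hN
  have h0 : Fin.castLE hN 0 = (0 : Fin (n + 2)) := rfl
  have h1 : Fin.castLE hN 1 = (1 : Fin (n + 2)) := rfl
  have hall : (∀ i : Fin (n + 2), 2 ≤ (i : ℕ) → x i = 0) ↔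
      ∀ i : Fin n, x i.succ.succ = 0 := by
    simp [Fin.forall_fin_succ]
  have hx (y : Fin (n + 2) → Fin 2) : x = y ↔
      x 0 = y 0 ∧ x 1 = y 1 ∧ ∀ i : Fin n, x i.succ.succ = y i.succ.succ := by
    simp [funext_iff, Fin.forall_fin_succ]
  have hs0 (i : Fin n) : (Pi.single 0 1 : Fin (n + 2) → Fin 2) i.succ.succ = 0 :=
    Pi.single_eq_of_ne (Fin.succ_ne_zero _) _
  have hs1 (i : Fin n) : (Pi.single 1 1 : Fin (n + 2) → Fin 2) i.succ.succ = 0 :=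
    Pi.single_eq_of_ne (by simp [Fin.ext_iff]) _
  unfold psiPlusExt psiPlus
  simp only [h0, h1, hall, hx (Pi.single 0 1), hx (Pi.single 1 1), hs0, hs1]
  by_cases h : ∀ i : Fin n, x i.succ.succ = 0
  · obtain h2 | h2 : x 0 = 0 ∨ x 0 = 1 := by omega
    all_goals
      obtain h3 | h3 : x 1 = 0 ∨ x 1 = 1 := by omega
      all_goals simp [h, h2, h3]
  · simp [h]

lemma psiPlusExt_expectation (N : ℕ) (hN : 2 ≤ N)
    (ρ : (Fin N → Fin 2) → (Fin N → Fin 2) → ℂ) :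
    ∑ x : Fin N → Fin 2, ∑ y : Fin N → Fin 2,
        (starRingEnd ℂ) (psiPlusExt N hN x) * ρ x y * psiPlusExt N hN y =
      1 / 2 * ∑ c : Fin 2, ∑ d : Fin 2,
        ρ (Pi.single (Fin.castLE hN c) 1) (Pi.single (Fin.castLE hN d) 1) := by
  have hs : ((1 / Real.sqrt 2 : ℝ) : ℂ) * ((1 / Real.sqrt 2 : ℝ) : ℂ) = 1 / 2 := by
    rw [← Complex.ofReal_mul, div_mul_div_comm, Real.mul_self_sqrt zero_le_two]
    simp
  have (x y : Fin N → Fin 2) :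
      (starRingEnd ℂ) (psiPlusExt N hN x) * ρ x y * psiPlusExt N hN y =
      1 / 2 * (((if x = Pi.single (Fin.castLE hN 0) 1 then 1 else 0) +
        (if x = Pi.single (Fin.castLE hN 1) 1 then 1 else 0)) *
        (ρ x y * ((if y = Pi.single (Fin.castLE hN 0) 1 then 1 else 0) +
        (if y = Pi.single (Fin.castLE hN 1) 1 then 1 else 0)))) := by
    rw [psiPlusExt_eq, psiPlusExt_eq, map_mul, Complex.conj_ofReal, map_add, ← hs]
    simp only [apply_ite (starRingEnd ℂ), map_one, map_zero]
    ring
  simp_rw [this, ← Finset.mul_sum]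
  congr 1
  simp [mul_add, add_mul, Finset.sum_add_distrib, Fin.sum_univ_two]

/-- Under N-fold depolarizing noise, the fidelity of the anonymous
entanglement produced by the W-state protocol equals
(1+q)(N(q−1)² + 4q(1+q)) / (4(N(1−q)+4q)):
⟨v, ρ v⟩ / Tr[ρ·(1⊗P₀)] with ρ = 𝒟_q^{⊗N}(|W_N⟩⟨W_N|) and v = ψ⁺ ⊗ |0…0⟩. -/
theorem W_depolarizing_fidelity (N : ℕ) (hN : 2 ≤ N) (q : ℝ) (hq : q ∈ Set.Icc (0 : ℝ) 1) :
    (∑ x : Fin N → Fin 2, ∑ y : Fin N → Fin 2,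
        (starRingEnd ℂ) (psiPlusExt N hN x) *
          depolarize N q (fun x y => Wstate N x * (starRingEnd ℂ) (Wstate N y)) x y *
          psiPlusExt N hN y)
      /
    (∑ x ∈ Finset.univ.filter
        (fun x : Fin N → Fin 2 => ∀ i : Fin N, 2 ≤ (i : ℕ) → x i = 0),
      depolarize N q (fun x y => Wstate N x * (starRingEnd ℂ) (Wstate N y)) x x)
    = (((1 + q) * (N * (q - 1) ^ 2 + 4 * q * (1 + q)) / (4 * (N * (1 - q) + 4 * q)) : ℝ) : ℂ) := by
  have hq1 : (1 + q : ℂ) ≠ 0 := by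
    have : (1 + q : ℝ) ≠ 0 := by linarith [hq.1]
    exact_mod_cast this
  have hden : (N * (1 - q) + 4 * q : ℂ) ≠ 0 := by
    have : (N * (1 - q) + 4 * q : ℝ) ≠ 0 := by
      have hN' : (2 : ℝ) ≤ N := by exact_mod_cast hN
      nlinarith [hq.1, hq.2]
    exact_mod_cast this
  have hN0 : (N : ℂ) ≠ 0 := by
    have : N ≠ 0 := by omega
    exact_mod_cast this
  have hcd : Fin.castLE hN 0 ≠ Fin.castLE hN 1 := by simp [Fin.ext_iff]
  have hiff (i : Fin N) : 2 ≤ (i : ℕ) ↔ i ≠ Fin.castLE hN 0 ∧ i ≠ Fin.castLE hN 1 := by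
    simp only [ne_eq, Fin.ext_iff, Fin.val_castLE, Fin.val_zero, Fin.val_one]
    omega
  simp_rw [hiff]
  rw [psiPlusExt_expectation, sum_depolarize_Wstate_diag N q hq1 _ _ hcd]
  simp only [Fin.sum_univ_two]
  rw [depolarize_Wstate_single N q hq1, depolarize_Wstate_single N q hq1,
    depolarize_Wstate_single_ne N q hq1 _ _ hcd, depolarize_Wstate_single_ne N q hq1 _ _ hcd.symm]
  have hp : ((1 + q : ℂ) / 2) ^ N ≠ 0 := pow_ne_zero _ (div_ne_zero hq1 two_ne_zero)
  have htr : (2 + (N - 2) * ((1 - q) / (1 + q)) : ℂ) = (N * (1 - q) + 4 * q) / (1 + q) := by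
    field_simp
    ring
  rw [htr]
  push_cast
  generalize ((1 + q : ℂ) / 2) ^ N = P at hp ⊢
  rw [div_eq_div_iff (by simp [hN0, hp, hq1, hden]) (mul_ne_zero (by norm_num) hden)]
  field_simp
  ring
end
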